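/- Dual Kato smoothing estimate (estimate (dual-smooth)): there exists C>0 such that for every Schwartz function f on ℝ×ℝ³, ‖ ∫_ℝ U(−t') ∇f(t',·) dt' ‖_{L²(ℝ³)} ≤ C ∫_ℝ ( ∫_ℝ ∫_{ℝ²} |f(t,x,y,z)|² dy dz dt )^{1/2} dx, where ∇ is the spatial gradient (so the left-hand side is the L² norm of an ℝ³-valued function). -/

import Mathlib

open MeasureTheory Real Filter
open scoped ENNReal

noncomputable section

/-- Euclidean dot product on ℝ³ (realized as ℝ × ℝ × ℝ). -/
def dot3 (a b : ℝ × ℝ × ℝ) : ℝ := a.1 * b.1 + a.2.1 * b.2.1 + a.2.2 * b.2.2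

/-- Euclidean norm on ℝ³. -/
def en3 (ξ : ℝ × ℝ × ℝ) : ℝ := Real.sqrt (dot3 ξ ξ)

/-- The Zakharov–Kuznetsov dispersion relation ω(ξ,η,μ) = ξ(ξ²+η²+μ²). -/
def omega3 (ξ : ℝ × ℝ × ℝ) : ℝ := ξ.1 * (ξ.1 ^ 2 + ξ.2.1 ^ 2 + ξ.2.2 ^ 2)

/-- Fourier transform on ℝ³, with normalization (2π)⁻³ ∫ e^{-i x·ξ} φ(x) dx. -/
def FT3 (φ : ℝ × ℝ × ℝ → ℂ) (ξ : ℝ × ℝ × ℝ) : ℂ :=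
  ((((2 * π) ^ 3)⁻¹ : ℝ) : ℂ) * ∫ x : ℝ × ℝ × ℝ, Complex.exp (-Complex.I * (dot3 x ξ : ℂ)) * φ x

/-- Inverse Fourier transform on ℝ³: ∫ e^{i x·ξ} g(ξ) dξ. -/
def invFT3 (g : ℝ × ℝ × ℝ → ℂ) (x : ℝ × ℝ × ℝ) : ℂ :=
  ∫ ξ : ℝ × ℝ × ℝ, Complex.exp (Complex.I * (dot3 x ξ : ℂ)) * g ξ

/-- The free Zakharov–Kuznetsov evolution U(t)φ(x̄) = ∫ e^{i(x̄·ξ̄ + tω(ξ̄))} φ̂(ξ̄) dξ̄. -/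
def U3 (φ : ℝ × ℝ × ℝ → ℂ) (t : ℝ) (x : ℝ × ℝ × ℝ) : ℂ :=
  ∫ ξ : ℝ × ℝ × ℝ, Complex.exp (Complex.I * ((dot3 x ξ + t * omega3 ξ : ℝ) : ℂ)) * FT3 φ ξ

/-- L² norm on ℝ³. -/
def L2norm3 (φ : ℝ × ℝ × ℝ → ℂ) : ℝ := Real.sqrt (∫ x : ℝ × ℝ × ℝ, ‖φ x‖ ^ 2)

/-- j-th coordinate of a point of ℝ³. -/
def coord3 (j : Fin 3) (ξ : ℝ × ℝ × ℝ) : ℝ := ![ξ.1, ξ.2.1, ξ.2.2] j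

/-- Littlewood–Paley ring cutoff δ_k(ξ̄) = p(2^{-k-1}ξ̄) − p(2^{-k}ξ̄) on ℝ³. -/
def delta3 (p : ℝ × ℝ × ℝ → ℝ) (k : ℤ) (ξ : ℝ × ℝ × ℝ) : ℝ :=
  p ((2:ℝ) ^ (-k-1) • ξ) - p ((2:ℝ) ^ (-k) • ξ)

/-- 1D rescaled cutoff p_k(ξ) = p(2^{-k}ξ). -/
def pk1 (p : ℝ → ℝ) (k : ℤ) (ξ : ℝ) : ℝ := p ((2:ℝ) ^ (-k) * ξ)

/-- 1D ring cutoff δ_k(ξ) = p(2^{-k-1}ξ) − p(2^{-k}ξ). -/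
def dk1 (p : ℝ → ℝ) (k : ℤ) (ξ : ℝ) : ℝ := p ((2:ℝ) ^ (-k-1) * ξ) - p ((2:ℝ) ^ (-k) * ξ)

/-- Oscillatory integral I with three 1D symbols:
I(t,x̄) = ∫ e^{i(x̄·ξ̄+tω(ξ̄))} ψ₁(ξ)ψ₂(η)ψ₃(μ) dξ̄. -/
def oscI (ψ₁ ψ₂ ψ₃ : ℝ → ℝ) (t : ℝ) (x : ℝ × ℝ × ℝ) : ℂ :=
  ∫ ξ : ℝ × ℝ × ℝ, Complex.exp (Complex.I * ((dot3 x ξ + t * omega3 ξ : ℝ) : ℂ)) *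
    ((ψ₁ ξ.1 * ψ₂ ξ.2.1 * ψ₃ ξ.2.2 : ℝ) : ℂ)

/-- j-th component of ∫_ℝ U(-t') ∇f(t',·) dt', on the frequency side. -/
def dualSmooth (f : ℝ × (ℝ × ℝ × ℝ) → ℂ) (j : Fin 3) (x : ℝ × ℝ × ℝ) : ℂ :=
  ∫ s : ℝ, ∫ ξ : ℝ × ℝ × ℝ,
    Complex.exp (Complex.I * ((dot3 x ξ + (-s) * omega3 ξ : ℝ) : ℂ)) *
      (Complex.I * (coord3 j ξ : ℂ)) * FT3 (fun w => f (s, w)) ξ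

open SchwartzMap FourierTransform

instance isAddHaarMeasure_volume_prod_real {E : Type*} [NormedAddCommGroup E] [MeasureSpace E]
    [BorelSpace E] [SecondCountableTopology E] [SFinite (volume : Measure E)]
    [(volume : Measure E).IsAddHaarMeasure] : (volume : Measure (ℝ × E)).IsAddHaarMeasure :=
  inferInstanceAs ((volume : Measure ℝ).prod (volume : Measure E)).IsAddHaarMeasure

instance hasTemperateGrowth_volume_real_prod_four :
    (volume : Measure (ℝ × ℝ × ℝ × ℝ)).HasTemperateGrowth :=
  Measure.IsAddHaarMeasure.instHasTemperateGrowth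

/-- The continuous linear identification of `ℝ × ℝ × ℝ` with its Euclidean version. -/
def euclid3 : (ℝ × ℝ × ℝ) ≃L[ℝ] WithLp 2 (ℝ × WithLp 2 (ℝ × ℝ)) :=
  ((ContinuousLinearEquiv.refl ℝ ℝ).prodCongr
    (WithLp.prodContinuousLinearEquiv 2 ℝ ℝ ℝ).symm).trans
    (WithLp.prodContinuousLinearEquiv 2 ℝ ℝ (WithLp 2 (ℝ × ℝ))).symm

/-- The continuous linear identification of `ℝ × ℝ × ℝ × ℝ` with its Euclidean version. -/
def euclid4 : (ℝ × ℝ × ℝ × ℝ) ≃L[ℝ] WithLp 2 (ℝ × WithLp 2 (ℝ × WithLp 2 (ℝ × ℝ))) :=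
  ((ContinuousLinearEquiv.refl ℝ ℝ).prodCongr euclid3).trans
    (WithLp.prodContinuousLinearEquiv 2 ℝ ℝ (WithLp 2 (ℝ × WithLp 2 (ℝ × ℝ)))).symm

lemma measurePreserving_euclid3 : MeasurePreserving euclid3 := by
  have h : MeasurePreserving (Prod.map (id : ℝ → ℝ) (WithLp.toLp 2 : ℝ × ℝ → _)) :=
    (MeasurePreserving.id volume).prod (WithLp.volume_preserving_toLp ℝ ℝ)
  exact (WithLp.volume_preserving_toLp ℝ (WithLp 2 (ℝ × ℝ))).comp h

lemma measurePreserving_euclid4 : MeasurePreserving euclid4 := by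
  have h : MeasurePreserving (Prod.map (id : ℝ → ℝ) euclid3) :=
    (MeasurePreserving.id volume).prod measurePreserving_euclid3
  exact (WithLp.volume_preserving_toLp ℝ (WithLp 2 (ℝ × WithLp 2 (ℝ × ℝ)))).comp h

lemma inner_euclid3 (x y : ℝ × ℝ × ℝ) : inner ℝ (euclid3 x) (euclid3 y) = dot3 x y := by
  simp [euclid3, dot3, WithLp.prod_inner_apply, mul_comm]
  ring

lemma inner_euclid4 (x y : ℝ × ℝ × ℝ × ℝ) :
    inner ℝ (euclid4 x) (euclid4 y) = x.1 * y.1 + dot3 x.2 y.2 := by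
  rw [← inner_euclid3]
  simp [euclid4, WithLp.prod_inner_apply, mul_comm]

/-- Multiplication by `(2π)⁻¹` as a continuous linear equivalence. -/
def scaleEquiv (E : Type*) [NormedAddCommGroup E] [NormedSpace ℝ E] : E ≃L[ℝ] E :=
  ContinuousLinearEquiv.smulLeft (Units.mk0 ((2 * π)⁻¹ : ℝ) (by positivity))

lemma scaleEquiv_apply {E : Type*} [NormedAddCommGroup E] [NormedSpace ℝ E] (x : E) :
    scaleEquiv E x = (2 * π)⁻¹ • x := rfl

/-- The Fourier transform on `ℝ × ℝ × ℝ` with kernel `e^{-i x·ξ}`, as a Schwartz function. -/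
def ft3 (g : 𝓢(ℝ × ℝ × ℝ, ℂ)) : 𝓢(ℝ × ℝ × ℝ, ℂ) :=
  compCLMOfContinuousLinearEquiv ℂ ((scaleEquiv _).trans euclid3)
    (𝓕 (compCLMOfContinuousLinearEquiv ℂ euclid3.symm g))

/-- The Fourier transform on `ℝ × ℝ × ℝ × ℝ` with kernel `e^{-i p·q}`, as a Schwartz function. -/
def ft4 (g : 𝓢(ℝ × ℝ × ℝ × ℝ, ℂ)) : 𝓢(ℝ × ℝ × ℝ × ℝ, ℂ) :=
  compCLMOfContinuousLinearEquiv ℂ ((scaleEquiv _).trans euclid4)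
    (𝓕 (compCLMOfContinuousLinearEquiv ℂ euclid4.symm g))

lemma ft3_apply (g : 𝓢(ℝ × ℝ × ℝ, ℂ)) (ξ : ℝ × ℝ × ℝ) :
    ft3 g ξ = ∫ x, Complex.exp (-Complex.I * (dot3 x ξ : ℂ)) * g x := by
  rw [ft3, compCLMOfContinuousLinearEquiv_apply, Function.comp_apply, fourier_coe,
    Real.fourier_eq', ← measurePreserving_euclid3.integral_comp'
      (f := euclid3.toHomeomorph.toMeasurableEquiv)]
  refine integral_congr_ae (.of_forall fun x ↦ ?_)
  simp only [Homeomorph.toMeasurableEquiv_coe, ContinuousLinearEquiv.coe_toHomeomorph,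
    ContinuousLinearEquiv.trans_apply, scaleEquiv_apply, map_smul, inner_smul_right,
    inner_euclid3, compCLMOfContinuousLinearEquiv_apply, Function.comp_apply,
    ContinuousLinearEquiv.symm_apply_apply, smul_eq_mul]
  congr 2
  push_cast
  field_simp

lemma ft4_apply (g : 𝓢(ℝ × ℝ × ℝ × ℝ, ℂ)) (q : ℝ × ℝ × ℝ × ℝ) :
    ft4 g q = ∫ p : ℝ × ℝ × ℝ × ℝ,
      Complex.exp (-Complex.I * ((p.1 * q.1 + dot3 p.2 q.2 : ℝ) : ℂ)) * g p := by
  rw [ft4, compCLMOfContinuousLinearEquiv_apply, Function.comp_apply, fourier_coe,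
    Real.fourier_eq', ← measurePreserving_euclid4.integral_comp'
      (f := euclid4.toHomeomorph.toMeasurableEquiv)]
  refine integral_congr_ae (.of_forall fun x ↦ ?_)
  simp only [Homeomorph.toMeasurableEquiv_coe, ContinuousLinearEquiv.coe_toHomeomorph,
    ContinuousLinearEquiv.trans_apply, scaleEquiv_apply, map_smul, inner_smul_right,
    inner_euclid4, compCLMOfContinuousLinearEquiv_apply, Function.comp_apply,
    ContinuousLinearEquiv.symm_apply_apply, smul_eq_mul]
  congr 2
  push_cast
  field_simp

lemma integral_norm_sq_ft3 (g : 𝓢(ℝ × ℝ × ℝ, ℂ)) :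
    ∫ ξ, ‖ft3 g ξ‖ ^ 2 = (2 * π) ^ 3 * ∫ x, ‖g x‖ ^ 2 := by
  have h := integral_norm_sq_fourier (compCLMOfContinuousLinearEquiv ℂ euclid3.symm g)
  rw [← measurePreserving_euclid3.integral_comp' (f := euclid3.toHomeomorph.toMeasurableEquiv),
    ← measurePreserving_euclid3.integral_comp' (f := euclid3.toHomeomorph.toMeasurableEquiv)] at h
  simp only [Homeomorph.toMeasurableEquiv_coe, ContinuousLinearEquiv.coe_toHomeomorph,
    compCLMOfContinuousLinearEquiv_apply, Function.comp_apply,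
    ContinuousLinearEquiv.symm_apply_apply] at h
  rw [← h]
  have h2 := Measure.integral_comp_smul (volume : Measure (ℝ × ℝ × ℝ)) (fun ξ ↦
    ‖𝓕 (compCLMOfContinuousLinearEquiv ℂ euclid3.symm g) (euclid3 ξ)‖ ^ 2) ((2 * π)⁻¹)
  simp only [Module.finrank_prod, Module.finrank_self, smul_eq_mul] at h2
  refine Eq.trans h2 ?_
  congr 1
  rw [abs_of_pos (by positivity), inv_pow, inv_inv]

lemma lintegral_enorm_sq_ofReal (g : 𝓢(ℝ × ℝ × ℝ, ℂ)) :
    ∫⁻ x, ‖g x‖ₑ ^ 2 = ENNReal.ofReal (∫ x, ‖g x‖ ^ 2) := by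
  have h : Integrable (fun x ↦ ‖g x‖ ^ 2) := (g.memLp 2).integrable_norm_pow (by norm_num)
  rw [ofReal_integral_eq_lintegral_ofReal h (.of_forall fun x ↦ by positivity)]
  refine lintegral_congr fun x ↦ ?_
  rw [ENNReal.ofReal_pow (norm_nonneg _), ofReal_norm]

lemma lintegral_enorm_sq_ft3 (g : 𝓢(ℝ × ℝ × ℝ, ℂ)) :
    ∫⁻ ξ, ‖ft3 g ξ‖ₑ ^ 2 = ENNReal.ofReal ((2 * π) ^ 3) * ∫⁻ x, ‖g x‖ₑ ^ 2 := by
  rw [lintegral_enorm_sq_ofReal, lintegral_enorm_sq_ofReal, integral_norm_sq_ft3,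
    ENNReal.ofReal_mul (by positivity)]

/-- The Minkowski integral inequality in `L²`. -/
lemma lintegral_sq_lintegral_le {α β : Type*} [MeasurableSpace α] [MeasurableSpace β]
    (μ : Measure α) (ν : Measure β) [SFinite μ] [SFinite ν] {H : α → β → ℝ≥0∞}
    (hH : Measurable (Function.uncurry H)) :
    ∫⁻ ξ, (∫⁻ x, H x ξ ∂μ) ^ 2 ∂ν ≤ (∫⁻ x, (∫⁻ ξ, H x ξ ^ 2 ∂ν) ^ (1 / 2 : ℝ) ∂μ) ^ 2 := by
  have hx (x : α) : Measurable (H x) := hH.comp measurable_prodMk_left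
  have hξ (ξ : β) : Measurable fun x ↦ H x ξ := hH.comp measurable_prodMk_right
  have h3 : Measurable fun p : (β × α) × α ↦ H p.1.2 p.1.1 * H p.2 p.1.1 :=
    (hH.comp (by fun_prop : Measurable fun p : (β × α) × α ↦ (p.1.2, p.1.1))).mul
      (hH.comp (by fun_prop : Measurable fun p : (β × α) × α ↦ (p.2, p.1.1)))
  have hN : Measurable fun x ↦ (∫⁻ ξ, H x ξ ^ 2 ∂ν) ^ (1 / 2 : ℝ) :=
    (Measurable.lintegral_prod_right' (f := fun p : α × β ↦ H p.1 p.2 ^ 2)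
      (hH.pow_const 2)).pow_const _
  calc ∫⁻ ξ, (∫⁻ x, H x ξ ∂μ) ^ 2 ∂ν
      = ∫⁻ ξ, ∫⁻ x, ∫⁻ y, H x ξ * H y ξ ∂μ ∂μ ∂ν := by
        refine lintegral_congr fun ξ ↦ ?_
        rw [sq, ← lintegral_mul_const _ (hξ ξ)]
        exact lintegral_congr fun x ↦ (lintegral_const_mul _ (hξ ξ)).symm
    _ = ∫⁻ x, ∫⁻ ξ, ∫⁻ y, H x ξ * H y ξ ∂μ ∂ν ∂μ :=
        lintegral_lintegral_swap (h3.lintegral_prod_right').aemeasurable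
    _ = ∫⁻ x, ∫⁻ y, ∫⁻ ξ, H x ξ * H y ξ ∂ν ∂μ ∂μ := by
        refine lintegral_congr fun x ↦ lintegral_lintegral_swap ?_
        exact (h3.comp (by fun_prop : Measurable fun p : β × α ↦ ((p.1, x), p.2))).aemeasurable
    _ ≤ ∫⁻ x, ∫⁻ y, (∫⁻ ξ, H x ξ ^ 2 ∂ν) ^ (1 / 2 : ℝ) *
          (∫⁻ ξ, H y ξ ^ 2 ∂ν) ^ (1 / 2 : ℝ) ∂μ ∂μ := by
        refine lintegral_mono fun x ↦ lintegral_mono fun y ↦ ?_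
        have := ENNReal.lintegral_mul_le_Lp_mul_Lq ν Real.HolderConjugate.two_two
          (hx x).aemeasurable (hx y).aemeasurable
        simpa using this
    _ = (∫⁻ x, (∫⁻ ξ, H x ξ ^ 2 ∂ν) ^ (1 / 2 : ℝ) ∂μ) ^ 2 := by
        rw [sq, ← lintegral_mul_const _ hN]
        exact lintegral_congr fun x ↦ lintegral_const_mul _ hN

lemma hasDerivAt_omega3 (ξ : ℝ) (k : ℝ × ℝ) :
    HasDerivAt (fun ξ : ℝ ↦ omega3 (ξ, k)) (3 * ξ ^ 2 + k.1 ^ 2 + k.2 ^ 2) ξ := by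
  have h := (hasDerivAt_id ξ).mul
    ((((hasDerivAt_id ξ).pow 2).add_const (k.1 ^ 2)).add_const (k.2 ^ 2))
  refine h.congr_deriv ?_
  simp
  ring

lemma injective_omega3 (k : ℝ × ℝ) : Function.Injective fun ξ : ℝ ↦ omega3 (ξ, k) := by
  intro a b h
  by_contra hab
  simp only [omega3] at h
  have h1 : (a - b) * (a ^ 2 + a * b + b ^ 2 + k.1 ^ 2 + k.2 ^ 2) = 0 := by linear_combination h
  have h2 := (mul_eq_zero.1 h1).resolve_left (sub_ne_zero.2 hab)
  have ha : a = 0 := by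
    nlinarith [sq_nonneg (a + 2 * b), sq_nonneg k.1, sq_nonneg k.2, sq_nonneg a]
  have hb : b = 0 := by
    nlinarith [sq_nonneg (2 * a + b), sq_nonneg k.1, sq_nonneg k.2, sq_nonneg b]
  exact hab (ha.trans hb.symm)

lemma continuous_dot3 : Continuous fun p : (ℝ × ℝ × ℝ) × (ℝ × ℝ × ℝ) ↦ dot3 p.1 p.2 := by
  unfold dot3
  fun_prop

lemma continuous_omega3 : Continuous omega3 := by
  unfold omega3
  fun_prop

/-- The change of variables `τ = ω(ξ, η, μ)`, whose Jacobian dominates `|ξ̄|²`. -/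
lemma lintegral_dot3_mul_comp_omega3_le {G : ℝ × ℝ × ℝ → ℝ≥0∞} (hG : Measurable G) :
    ∫⁻ ξ : ℝ × ℝ × ℝ, ENNReal.ofReal (dot3 ξ ξ) * G (omega3 ξ, ξ.2) ≤ ∫⁻ q, G q := by
  have hm : Measurable fun ξ : ℝ × ℝ × ℝ ↦ ENNReal.ofReal (dot3 ξ ξ) * G (omega3 ξ, ξ.2) :=
    (continuous_dot3.comp (continuous_id.prodMk continuous_id)).measurable.ennreal_ofReal.mul
      (hG.comp (continuous_omega3.measurable.prodMk measurable_snd))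
  rw [Measure.volume_eq_prod, lintegral_prod_symm _ hm.aemeasurable,
    lintegral_prod_symm _ hG.aemeasurable]
  refine lintegral_mono fun k ↦ ?_
  have h := lintegral_image_eq_lintegral_abs_deriv_mul MeasurableSet.univ
    (fun ξ _ ↦ (hasDerivAt_omega3 ξ k).hasDerivWithinAt) (injective_omega3 k).injOn
    (fun τ ↦ G (τ, k))
  rw [Measure.restrict_univ] at h
  calc ∫⁻ ξ, ENNReal.ofReal (dot3 (ξ, k) (ξ, k)) * G (omega3 (ξ, k), k)
      ≤ ∫⁻ ξ, ENNReal.ofReal |3 * ξ ^ 2 + k.1 ^ 2 + k.2 ^ 2| * G (omega3 (ξ, k), k) := by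
        refine lintegral_mono fun ξ ↦ mul_le_mul_left (ENNReal.ofReal_le_ofReal ?_) _
        refine le_trans ?_ (le_abs_self _)
        simp only [dot3]
        nlinarith [sq_nonneg ξ]
    _ = _ := h.symm
    _ ≤ ∫⁻ τ, G (τ, k) := setLIntegral_le_lintegral _ _

lemma exists_forall_norm_le_inv_one_add_sq (f : 𝓢(ℝ × ℝ × ℝ × ℝ, ℂ)) :
    ∃ C : ℝ, 0 ≤ C ∧ ∀ t x y z : ℝ, ‖f (t, x, y, z)‖ ≤
      C * ((1 + t ^ 2)⁻¹ * ((1 + x ^ 2)⁻¹ * ((1 + y ^ 2)⁻¹ * (1 + z ^ 2)⁻¹))) := by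
  refine ⟨2 ^ 8 * (Finset.Iic (8, 0)).sup (fun m ↦ SchwartzMap.seminorm ℝ m.1 m.2) f,
    by positivity, fun t x y z ↦ ?_⟩
  have h := one_add_le_sup_seminorm_apply (𝕜 := ℝ) (m := (8, 0)) le_rfl le_rfl f (t, x, y, z)
  rw [norm_iteratedFDeriv_zero] at h
  set r := ‖(t, x, y, z)‖ with hr
  have key {a : ℝ} (ha : |a| ≤ r) : 1 + a ^ 2 ≤ (1 + r) ^ 2 := by
    nlinarith [abs_nonneg a, sq_abs a]
  have h0 : r = max |t| (max |x| (max |y| |z|)) := by simp [hr, Prod.norm_def]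
  have ht := key (a := t) (by simp [h0])
  have hx := key (a := x) (by simp [h0])
  have hy := key (a := y) (by simp [h0])
  have hz := key (a := z) (by simp [h0])
  have hprod : (1 + t ^ 2) * ((1 + x ^ 2) * ((1 + y ^ 2) * (1 + z ^ 2))) ≤ (1 + r) ^ 8 := by
    calc _ ≤ (1 + r) ^ 2 * ((1 + r) ^ 2 * ((1 + r) ^ 2 * (1 + r) ^ 2)) := by gcongr
      _ = _ := by ring
  rw [← mul_inv, ← mul_inv, ← mul_inv, ← div_eq_mul_inv, le_div_iff₀ (by positivity), mul_comm]
  exact (mul_le_mul_of_nonneg_right hprod (norm_nonneg _)).trans h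

lemma integrable_inv_one_add_sq_prod :
    Integrable fun w : ℝ × ℝ × ℝ ↦
      (1 + w.1 ^ 2)⁻¹ * ((1 + w.2.1 ^ 2)⁻¹ * (1 + w.2.2 ^ 2)⁻¹) :=
  integrable_inv_one_add_sq.mul_prod (integrable_inv_one_add_sq.mul_prod integrable_inv_one_add_sq)

lemma norm_exp_neg_I_mul (a : ℝ) : ‖Complex.exp (-Complex.I * (a : ℂ))‖ = 1 := by
  simpa [mul_comm] using Complex.norm_exp_ofReal_mul_I (-a)

lemma norm_exp_I_mul (a : ℝ) : ‖Complex.exp (Complex.I * (a : ℂ))‖ = 1 := by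
  simp [Complex.norm_exp]

/-- The Fourier transform of `f (s, ·)` at `ξ`, without normalisation. -/
def sliceFT (f : 𝓢(ℝ × ℝ × ℝ × ℝ, ℂ)) (s : ℝ) (ξ : ℝ × ℝ × ℝ) : ℂ :=
  ∫ w : ℝ × ℝ × ℝ, Complex.exp (-Complex.I * (dot3 w ξ : ℂ)) * f (s, w)

lemma integrable_slice (f : 𝓢(ℝ × ℝ × ℝ × ℝ, ℂ)) (s : ℝ) :
    Integrable fun w : ℝ × ℝ × ℝ ↦ f (s, w) := by
  obtain ⟨C, -, hC⟩ := exists_forall_norm_le_inv_one_add_sq f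
  refine ((integrable_inv_one_add_sq_prod.const_mul (1 + s ^ 2)⁻¹).const_mul C).mono'
    (f.continuous.comp (by fun_prop)).aestronglyMeasurable (.of_forall fun w ↦ hC _ _ _ _)

lemma integrable_exp_mul_slice (f : 𝓢(ℝ × ℝ × ℝ × ℝ, ℂ)) (s : ℝ) (ξ : ℝ × ℝ × ℝ) :
    Integrable fun w : ℝ × ℝ × ℝ ↦ Complex.exp (-Complex.I * (dot3 w ξ : ℂ)) * f (s, w) := by
  refine (integrable_slice f s).bdd_mul (c := 1) ?_ (.of_forall fun w ↦ ?_)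
  · unfold dot3
    exact Continuous.aestronglyMeasurable (by fun_prop)
  · exact (norm_exp_neg_I_mul _).le

lemma exists_norm_sliceFT_le (f : 𝓢(ℝ × ℝ × ℝ × ℝ, ℂ)) :
    ∃ C : ℝ, ∀ s ξ, ‖sliceFT f s ξ‖ ≤ C * (1 + s ^ 2)⁻¹ := by
  obtain ⟨C, -, hC⟩ := exists_forall_norm_le_inv_one_add_sq f
  refine ⟨C * ∫ w : ℝ × ℝ × ℝ, (1 + w.1 ^ 2)⁻¹ * ((1 + w.2.1 ^ 2)⁻¹ * (1 + w.2.2 ^ 2)⁻¹),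
    fun s ξ ↦ ?_⟩
  calc ‖sliceFT f s ξ‖ ≤ ∫ w : ℝ × ℝ × ℝ, C * ((1 + s ^ 2)⁻¹ *
        ((1 + w.1 ^ 2)⁻¹ * ((1 + w.2.1 ^ 2)⁻¹ * (1 + w.2.2 ^ 2)⁻¹))) := by
        refine norm_integral_le_of_norm_le
          ((integrable_inv_one_add_sq_prod.const_mul _).const_mul _) (.of_forall fun w ↦ ?_)
        rw [norm_mul, norm_exp_neg_I_mul, one_mul]
        exact hC _ _ _ _
    _ = _ := by
        rw [integral_const_mul, integral_const_mul]
        ring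

open LineDeriv in
lemma sliceFT_lineDerivOp (f : 𝓢(ℝ × ℝ × ℝ × ℝ, ℂ)) (v : ℝ × ℝ × ℝ) (s : ℝ)
    (ξ : ℝ × ℝ × ℝ) :
    sliceFT (∂_{((0 : ℝ), v)} f) s ξ = Complex.I * (dot3 v ξ : ℂ) * sliceFT f s ξ := by
  have hg (w : ℝ × ℝ × ℝ) : HasFDerivAt (fun w ↦ f (s, w))
      ((fderiv ℝ f (s, w)).comp (ContinuousLinearMap.inr ℝ ℝ (ℝ × ℝ × ℝ))) w :=
    (f.hasFDerivAt (s, w)).comp w (hasFDerivAt_prodMk_right s w)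
  have hl (w : ℝ × ℝ × ℝ) : HasLineDerivAt ℝ (fun w ↦ f (s, w)) (∂_{((0 : ℝ), v)} f (s, w)) w v := by
    have := (hg w).hasLineDerivAt v
    rwa [ContinuousLinearMap.comp_apply, ContinuousLinearMap.inr_apply,
      ← lineDerivOp_apply_eq_fderiv] at this
  have he (w : ℝ × ℝ × ℝ) : HasLineDerivAt ℝ
      (fun w ↦ Complex.exp (-Complex.I * (dot3 w ξ : ℂ)))
      (-Complex.I * (dot3 v ξ : ℂ) * Complex.exp (-Complex.I * (dot3 w ξ : ℂ))) w v := by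
    unfold HasLineDerivAt
    have h1 : HasDerivAt (fun t : ℝ ↦ dot3 (w + t • v) ξ) (dot3 v ξ) 0 := by
      have : (fun t : ℝ ↦ dot3 (w + t • v) ξ) = fun t ↦ dot3 w ξ + t * dot3 v ξ := by
        funext t
        simp [dot3]
        ring
      rw [this]
      simpa using ((hasDerivAt_id (0 : ℝ)).mul_const (dot3 v ξ)).const_add (dot3 w ξ)
    have h2 := (h1.ofReal_comp.const_mul (-Complex.I)).cexp
    refine h2.congr_deriv ?_
    simp
    ring
  have key := integral_bilinear_hasLineDerivAt_right_eq_neg_left_of_integrable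
    (μ := (volume : Measure (ℝ × ℝ × ℝ))) (B := ContinuousLinearMap.mul ℝ ℂ) (v := v)
    (f := fun w ↦ Complex.exp (-Complex.I * (dot3 w ξ : ℂ))) (g := fun w ↦ f (s, w))
    (f' := fun w ↦ -Complex.I * (dot3 v ξ : ℂ) * Complex.exp (-Complex.I * (dot3 w ξ : ℂ)))
    (g' := fun w ↦ ∂_{((0 : ℝ), v)} f (s, w))
    (by simpa [mul_assoc] using
      (integrable_exp_mul_slice f s ξ).const_mul (-Complex.I * (dot3 v ξ : ℂ)))
    (integrable_exp_mul_slice (∂_{((0 : ℝ), v)} f) s ξ)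
    (integrable_exp_mul_slice f s ξ)
    (fun w _ ↦ he w) (fun w _ ↦ hl w)
  simp only [ContinuousLinearMap.mul_apply', mul_assoc] at key
  rw [integral_const_mul, integral_const_mul] at key
  simp only [sliceFT]
  rw [key]
  ring

lemma sliceFT_sub (f g : 𝓢(ℝ × ℝ × ℝ × ℝ, ℂ)) (s : ℝ) (ξ : ℝ × ℝ × ℝ) :
    sliceFT (f - g) s ξ = sliceFT f s ξ - sliceFT g s ξ := by
  simp only [sliceFT, sub_apply, mul_sub]
  exact integral_sub (integrable_exp_mul_slice f s ξ) (integrable_exp_mul_slice g s ξ)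

open LineDeriv in
lemma exists_sliceFT_eq_one_add_sq_mul (f : 𝓢(ℝ × ℝ × ℝ × ℝ, ℂ)) (v : ℝ × ℝ × ℝ) :
    ∃ g : 𝓢(ℝ × ℝ × ℝ × ℝ, ℂ), ∀ s ξ,
      sliceFT g s ξ = ((1 + dot3 v ξ ^ 2 : ℝ) : ℂ) * sliceFT f s ξ := by
  refine ⟨f - ∂_{((0 : ℝ), v)} (∂_{((0 : ℝ), v)} f), fun s ξ ↦ ?_⟩
  rw [sliceFT_sub, sliceFT_lineDerivOp, sliceFT_lineDerivOp]
  push_cast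
  linear_combination (-(dot3 v ξ : ℂ) ^ 2 * sliceFT f s ξ) * Complex.I_sq

open LineDeriv in
lemma exists_norm_coord3_mul_sliceFT_le (f : 𝓢(ℝ × ℝ × ℝ × ℝ, ℂ)) (j : Fin 3) :
    ∃ C : ℝ, ∀ s ξ, ‖Complex.I * (coord3 j ξ : ℂ) * sliceFT f s ξ‖ ≤
      C * ((1 + s ^ 2)⁻¹ * ((1 + ξ.1 ^ 2)⁻¹ * ((1 + ξ.2.1 ^ 2)⁻¹ * (1 + ξ.2.2 ^ 2)⁻¹))) := by
  obtain ⟨v, hv⟩ : ∃ v : ℝ × ℝ × ℝ, ∀ ξ, coord3 j ξ = dot3 v ξ := by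
    fin_cases j
    · exact ⟨(1, 0, 0), fun ξ ↦ by simp [coord3, dot3]⟩
    · exact ⟨(0, 1, 0), fun ξ ↦ by simp [coord3, dot3]⟩
    · exact ⟨(0, 0, 1), fun ξ ↦ by simp [coord3, dot3]⟩
  obtain ⟨g₁, h₁⟩ := exists_sliceFT_eq_one_add_sq_mul (∂_{((0 : ℝ), v)} f) (1, 0, 0)
  obtain ⟨g₂, h₂⟩ := exists_sliceFT_eq_one_add_sq_mul g₁ (0, 1, 0)
  obtain ⟨g₃, h₃⟩ := exists_sliceFT_eq_one_add_sq_mul g₂ (0, 0, 1)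
  obtain ⟨C, hC⟩ := exists_norm_sliceFT_le g₃
  refine ⟨C, fun s ξ ↦ ?_⟩
  have h := hC s ξ
  rw [h₃, h₂, h₁, sliceFT_lineDerivOp, ← hv, norm_mul, norm_mul, norm_mul, Complex.norm_real,
    Complex.norm_real, Complex.norm_real] at h
  simp only [dot3, one_mul, zero_mul, zero_add, add_zero] at h
  rw [Real.norm_of_nonneg (by positivity), Real.norm_of_nonneg (by positivity),
    Real.norm_of_nonneg (by positivity)] at h
  rw [← mul_assoc C, ← mul_inv, ← mul_inv, ← div_eq_mul_inv, le_div_iff₀ (by positivity)]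
  calc _ = _ := by ring
    _ ≤ _ := h

/-- The map `ξ̄ ↦ (ω(ξ̄), ξ̄)` onto the characteristic surface has temperate growth. -/
lemma hasTemperateGrowth_omega3_prodMk :
    (fun ξ : ℝ × ℝ × ℝ ↦ (omega3 ξ, ξ)).HasTemperateGrowth := by
  have h1 : (fun ξ : ℝ × ℝ × ℝ ↦ ξ.1).HasTemperateGrowth :=
    (ContinuousLinearMap.fst ℝ ℝ (ℝ × ℝ)).hasTemperateGrowth
  have h2 : (fun ξ : ℝ × ℝ × ℝ ↦ ξ.2.1).HasTemperateGrowth :=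
    ((ContinuousLinearMap.fst ℝ ℝ ℝ).comp (ContinuousLinearMap.snd ℝ ℝ (ℝ × ℝ))).hasTemperateGrowth
  have h3 : (fun ξ : ℝ × ℝ × ℝ ↦ ξ.2.2).HasTemperateGrowth :=
    ((ContinuousLinearMap.snd ℝ ℝ ℝ).comp (ContinuousLinearMap.snd ℝ ℝ (ℝ × ℝ))).hasTemperateGrowth
  have hω : omega3.HasTemperateGrowth := h1.mul (((h1.pow 2).add (h2.pow 2)).add (h3.pow 2))
  have h4 := (ContinuousLinearMap.inl ℝ ℝ (ℝ × ℝ × ℝ)).hasTemperateGrowth.comp hω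
  have h5 := h4.add (ContinuousLinearMap.inr ℝ ℝ (ℝ × ℝ × ℝ)).hasTemperateGrowth
  convert h5 using 2 with ξ
  simp

/-- The restriction of the space-time Fourier transform to the characteristic surface. -/
def restrictFT (f : 𝓢(ℝ × ℝ × ℝ × ℝ, ℂ)) : 𝓢(ℝ × ℝ × ℝ, ℂ) :=
  compCLM ℂ hasTemperateGrowth_omega3_prodMk
    ⟨1, 1, fun ξ ↦ by
      rw [one_mul, pow_one]
      exact (norm_snd_le (omega3 ξ, ξ)).trans (le_add_of_nonneg_left zero_le_one)⟩ (ft4 f)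

lemma restrictFT_apply (f : 𝓢(ℝ × ℝ × ℝ × ℝ, ℂ)) (ξ : ℝ × ℝ × ℝ) :
    restrictFT f ξ = ∫ p : ℝ × ℝ × ℝ × ℝ,
      Complex.exp (-Complex.I * ((p.1 * omega3 ξ + dot3 p.2 ξ : ℝ) : ℂ)) * f p :=
  ft4_apply f (omega3 ξ, ξ)

lemma integrable_exp_mul (f : 𝓢(ℝ × ℝ × ℝ × ℝ, ℂ)) (τ : ℝ) (ξ : ℝ × ℝ × ℝ) :
    Integrable fun p : ℝ × ℝ × ℝ × ℝ ↦
      Complex.exp (-Complex.I * ((p.1 * τ + dot3 p.2 ξ : ℝ) : ℂ)) * f p := by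
  refine f.integrable.bdd_mul (c := 1) ?_ (.of_forall fun p ↦ (norm_exp_neg_I_mul _).le)
  unfold dot3
  exact Continuous.aestronglyMeasurable (by fun_prop)

lemma integral_exp_mul_sliceFT (f : 𝓢(ℝ × ℝ × ℝ × ℝ, ℂ)) (ξ : ℝ × ℝ × ℝ) :
    ∫ s : ℝ, Complex.exp (-Complex.I * ((s * omega3 ξ : ℝ) : ℂ)) * sliceFT f s ξ =
      restrictFT f ξ := by
  rw [restrictFT_apply, Measure.volume_eq_prod, integral_prod _ (integrable_exp_mul f _ ξ)]
  refine integral_congr_ae (.of_forall fun s ↦ ?_)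
  simp only [sliceFT, ← integral_const_mul]
  refine integral_congr_ae (.of_forall fun w ↦ ?_)
  simp only [← mul_assoc, ← Complex.exp_add]
  congr 2
  push_cast
  ring

lemma stronglyMeasurable_sliceFT (f : 𝓢(ℝ × ℝ × ℝ × ℝ, ℂ)) :
    StronglyMeasurable fun p : ℝ × (ℝ × ℝ × ℝ) ↦ sliceFT f p.1 p.2 := by
  have h : Continuous fun q : (ℝ × (ℝ × ℝ × ℝ)) × (ℝ × ℝ × ℝ) ↦
      Complex.exp (-Complex.I * (dot3 q.2 q.1.2 : ℂ)) * f (q.1.1, q.2) := by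
    have := f.continuous
    unfold dot3
    fun_prop
  exact h.stronglyMeasurable.integral_prod_right'

lemma hasTemperateGrowth_I_mul_coord3 (j : Fin 3) :
    (fun ξ : ℝ × ℝ × ℝ ↦ Complex.I * (coord3 j ξ : ℂ)).HasTemperateGrowth := by
  have h : (coord3 j).HasTemperateGrowth := by
    fin_cases j
    · exact (ContinuousLinearMap.fst ℝ ℝ (ℝ × ℝ)).hasTemperateGrowth
    · exact ((ContinuousLinearMap.fst ℝ ℝ ℝ).comp
        (ContinuousLinearMap.snd ℝ ℝ (ℝ × ℝ))).hasTemperateGrowth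
    · exact ((ContinuousLinearMap.snd ℝ ℝ ℝ).comp
        (ContinuousLinearMap.snd ℝ ℝ (ℝ × ℝ))).hasTemperateGrowth
  fun_prop

/-- The function `iξ_j` times the restricted space-time Fourier transform. -/
def gradRestrictFT (f : 𝓢(ℝ × ℝ × ℝ × ℝ, ℂ)) (j : Fin 3) : 𝓢(ℝ × ℝ × ℝ, ℂ) :=
  smulLeftCLM ℂ (fun ξ : ℝ × ℝ × ℝ ↦ Complex.I * (coord3 j ξ : ℂ)) (restrictFT f)

lemma gradRestrictFT_apply (f : 𝓢(ℝ × ℝ × ℝ × ℝ, ℂ)) (j : Fin 3) (ξ : ℝ × ℝ × ℝ) :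
    gradRestrictFT f j ξ = Complex.I * (coord3 j ξ : ℂ) * restrictFT f ξ :=
  smulLeftCLM_apply_apply (hasTemperateGrowth_I_mul_coord3 j) _ _

lemma continuous_coord3 (j : Fin 3) : Continuous (coord3 j) := by
  fin_cases j
  · exact continuous_fst
  · exact continuous_snd.fst
  · exact continuous_snd.snd

lemma dualSmooth_eq (f : 𝓢(ℝ × ℝ × ℝ × ℝ, ℂ)) (j : Fin 3) (x : ℝ × ℝ × ℝ) :
    dualSmooth f j x = ((((2 * π) ^ 3)⁻¹ : ℝ) : ℂ) * ft3 (gradRestrictFT f j) (-x) := by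
  have hint : Integrable (Function.uncurry fun (s : ℝ) (ξ : ℝ × ℝ × ℝ) ↦
      Complex.exp (Complex.I * ((dot3 x ξ + (-s) * omega3 ξ : ℝ) : ℂ)) *
        (Complex.I * (coord3 j ξ : ℂ)) * FT3 (fun w ↦ f (s, w)) ξ)
      ((volume : Measure ℝ).prod (volume : Measure (ℝ × ℝ × ℝ))) := by
    obtain ⟨C, hC⟩ := exists_norm_coord3_mul_sliceFT_le f j
    refine (((integrable_inv_one_add_sq.mul_prod integrable_inv_one_add_sq_prod).const_mul
      C).const_mul (((2 * π) ^ 3)⁻¹)).mono' ?_ (.of_forall fun p ↦ ?_)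
    · have h1 : Continuous fun p : ℝ × (ℝ × ℝ × ℝ) ↦
          Complex.exp (Complex.I * ((dot3 x p.2 + (-p.1) * omega3 p.2 : ℝ) : ℂ)) *
            (Complex.I * (coord3 j p.2 : ℂ)) := by
        have := continuous_coord3 j
        have := continuous_omega3
        unfold dot3
        fun_prop
      exact (h1.stronglyMeasurable.mul
        ((stronglyMeasurable_sliceFT f).const_mul _)).aestronglyMeasurable
    · have h := hC p.1 p.2
      have hc : (0 : ℝ) ≤ ((2 * π) ^ 3)⁻¹ := by positivity
      calc _ = ((2 * π) ^ 3)⁻¹ * ‖Complex.I * (coord3 j p.2 : ℂ) * sliceFT f p.1 p.2‖ := by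
            simp only [Function.uncurry, FT3, norm_mul, norm_exp_I_mul, Complex.norm_real,
              Real.norm_of_nonneg hc, sliceFT]
            ring
        _ ≤ _ := mul_le_mul_of_nonneg_left h hc
  rw [dualSmooth, integral_integral_swap hint, ft3_apply, ← integral_const_mul]
  refine integral_congr_ae (.of_forall fun ξ ↦ ?_)
  simp only [gradRestrictFT_apply, ← integral_exp_mul_sliceFT, ← integral_const_mul]
  refine integral_congr_ae (.of_forall fun s ↦ ?_)
  have he : Complex.exp (Complex.I * ((dot3 x ξ + (-s) * omega3 ξ : ℝ) : ℂ)) =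
      Complex.exp (-Complex.I * (dot3 ξ (-x) : ℂ)) *
        Complex.exp (-Complex.I * ((s * omega3 ξ : ℝ) : ℂ)) := by
    rw [← Complex.exp_add]
    congr 1
    simp only [dot3, Prod.fst_neg, Prod.snd_neg]
    push_cast
    ring
  simp only [he, FT3, sliceFT]
  ring

lemma lintegral_sum_enorm_sq_dualSmooth (f : 𝓢(ℝ × ℝ × ℝ × ℝ, ℂ)) :
    ∫⁻ x, ∑ j : Fin 3, ‖dualSmooth f j x‖ₑ ^ 2 =
      ENNReal.ofReal (((2 * π) ^ 3)⁻¹) *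
        ∫⁻ ξ, (ENNReal.ofReal (en3 ξ) * ‖restrictFT f ξ‖ₑ) ^ 2 := by
  have hj (j : Fin 3) : ∫⁻ x, ‖dualSmooth f j x‖ₑ ^ 2 =
      ENNReal.ofReal (((2 * π) ^ 3)⁻¹) * ∫⁻ ξ, ‖gradRestrictFT f j ξ‖ₑ ^ 2 := by
    have hc : (0 : ℝ) < (2 * π) ^ 3 := by positivity
    simp only [dualSmooth_eq, enorm_mul, mul_pow]
    rw [lintegral_const_mul' _ _ (by finiteness),
      lintegral_neg_eq_self (fun x ↦ ‖ft3 (gradRestrictFT f j) x‖ₑ ^ 2), lintegral_enorm_sq_ft3,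
      ← mul_assoc]
    congr 1
    rw [← ofReal_norm, Complex.norm_real, Real.norm_of_nonneg (by positivity),
      ← ENNReal.ofReal_pow (by positivity), ← ENNReal.ofReal_mul (by positivity)]
    congr 1
    field_simp
  have hm (j : Fin 3) : Measurable fun x ↦ ‖dualSmooth f j x‖ₑ ^ 2 := by
    simp only [dualSmooth_eq]
    have := (ft3 (gradRestrictFT f j)).continuous
    exact Continuous.measurable (by fun_prop)
  rw [lintegral_finsetSum _ fun j _ ↦ hm j]
  simp only [hj, ← Finset.mul_sum]
  rw [← lintegral_finsetSum _ fun j _ ↦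
    ((gradRestrictFT f j).continuous.measurable.enorm.pow_const 2)]
  congr 1
  refine lintegral_congr fun ξ ↦ ?_
  have hd : 0 ≤ dot3 ξ ξ := by
    simp only [dot3]
    nlinarith [sq_nonneg ξ.1, sq_nonneg ξ.2.1, sq_nonneg ξ.2.2]
  simp only [gradRestrictFT_apply, ← ofReal_norm, norm_mul, Complex.norm_I, one_mul,
    Complex.norm_real]
  have he : 0 ≤ en3 ξ := Real.sqrt_nonneg _
  rw [← ENNReal.ofReal_mul he, ← ENNReal.ofReal_pow (by positivity)]
  simp only [← ENNReal.ofReal_pow (mul_nonneg (norm_nonneg _) (norm_nonneg _))]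
  rw [← ENNReal.ofReal_sum_of_nonneg fun j _ ↦ by positivity]
  congr 1
  rw [mul_pow, en3, Real.sq_sqrt hd]
  simp [Fin.sum_univ_three, coord3, dot3, mul_pow]
  ring

lemma hasTemperateGrowth_insert (x : ℝ) :
    (fun p : ℝ × ℝ × ℝ ↦ (p.1, x, p.2)).HasTemperateGrowth := by
  have h1 := ((ContinuousLinearMap.fst ℝ ℝ (ℝ × ℝ)).prod ((0 : ℝ × ℝ × ℝ →L[ℝ] ℝ).prod
    (ContinuousLinearMap.snd ℝ ℝ (ℝ × ℝ)))).hasTemperateGrowth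
  have h2 := h1.add (Function.HasTemperateGrowth.const (((0 : ℝ), x, (0 : ℝ × ℝ))))
  convert h2 using 2 with p
  simp

lemma antilipschitzWith_insert (x : ℝ) :
    AntilipschitzWith 1 fun p : ℝ × ℝ × ℝ ↦ (p.1, x, p.2) := by
  refine AntilipschitzWith.of_le_mul_dist fun p q ↦ ?_
  simp [Prod.dist_eq]

/-- The function `(t, y, z) ↦ f (t, x, y, z)` for fixed `x`. -/
def sliceX (f : 𝓢(ℝ × ℝ × ℝ × ℝ, ℂ)) (x : ℝ) : 𝓢(ℝ × ℝ × ℝ, ℂ) :=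
  compCLMOfAntilipschitz ℂ (hasTemperateGrowth_insert x) (antilipschitzWith_insert x) f

lemma sliceX_apply (f : 𝓢(ℝ × ℝ × ℝ × ℝ, ℂ)) (x : ℝ) (p : ℝ × ℝ × ℝ) :
    sliceX f x p = f (p.1, x, p.2) := rfl

/-- The equivalence exchanging the first two coordinates. -/
def swapFirst : (ℝ × ℝ × ℝ × ℝ) ≃ᵐ (ℝ × ℝ × ℝ × ℝ) :=
  (MeasurableEquiv.prodAssoc.symm.trans
    (MeasurableEquiv.prodCongr MeasurableEquiv.prodComm (.refl (ℝ × ℝ)))).trans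
    MeasurableEquiv.prodAssoc

lemma measurePreserving_swapFirst : MeasurePreserving swapFirst := by
  have h1 : MeasurePreserving (MeasurableEquiv.prodAssoc : (ℝ × ℝ) × (ℝ × ℝ) ≃ᵐ _) :=
    volume_preserving_prodAssoc
  have h2 : MeasurePreserving (Prod.map Prod.swap id : (ℝ × ℝ) × (ℝ × ℝ) → _) :=
    (Measure.measurePreserving_swap (μ := (volume : Measure ℝ))
      (ν := (volume : Measure ℝ))).prod (MeasurePreserving.id (volume : Measure (ℝ × ℝ)))
  exact h1.comp (h2.comp h1.symm)

lemma swapFirst_apply (p : ℝ × ℝ × ℝ × ℝ) : swapFirst p = (p.2.1, p.1, p.2.2) := rfl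

lemma restrictFT_eq_integral (f : 𝓢(ℝ × ℝ × ℝ × ℝ, ℂ)) (ξ : ℝ × ℝ × ℝ) :
    restrictFT f ξ = ∫ x : ℝ, Complex.exp (-Complex.I * ((x * ξ.1 : ℝ) : ℂ)) *
      ft3 (sliceX f x) (omega3 ξ, ξ.2) := by
  have hint := integrable_exp_mul f (omega3 ξ) ξ
  rw [← measurePreserving_swapFirst.integrable_comp_emb swapFirst.measurableEmbedding] at hint
  rw [restrictFT_apply, ← measurePreserving_swapFirst.integral_comp', Measure.volume_eq_prod]
  refine (integral_prod _ hint).trans ?_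
  refine integral_congr_ae (.of_forall fun x ↦ ?_)
  simp only [ft3_apply, ← integral_const_mul]
  refine integral_congr_ae (.of_forall fun p ↦ ?_)
  simp only [swapFirst_apply, sliceX_apply, ← mul_assoc, ← Complex.exp_add, Function.comp_apply]
  congr 2
  simp only [dot3]
  push_cast
  ring

lemma measurable_ft3_sliceX (f : 𝓢(ℝ × ℝ × ℝ × ℝ, ℂ)) :
    Measurable fun p : ℝ × (ℝ × ℝ × ℝ) ↦ ft3 (sliceX f p.1) p.2 := by
  have h : Continuous fun q : (ℝ × (ℝ × ℝ × ℝ)) × (ℝ × ℝ × ℝ) ↦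
      Complex.exp (-Complex.I * (dot3 q.2 q.1.2 : ℂ)) * f (q.2.1, q.1.1, q.2.2) := by
    have := f.continuous
    unfold dot3
    fun_prop
  simp only [ft3_apply, sliceX_apply]
  exact h.stronglyMeasurable.integral_prod_right'.measurable

lemma enorm_restrictFT_le (f : 𝓢(ℝ × ℝ × ℝ × ℝ, ℂ)) (ξ : ℝ × ℝ × ℝ) :
    ‖restrictFT f ξ‖ₑ ≤ ∫⁻ x : ℝ, ‖ft3 (sliceX f x) (omega3 ξ, ξ.2)‖ₑ := by
  rw [restrictFT_eq_integral]
  refine (enorm_integral_le_lintegral_enorm _).trans_eq (lintegral_congr fun x ↦ ?_)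
  rw [enorm_mul, ← ofReal_norm, norm_exp_neg_I_mul]
  simp

lemma integrable_sqrt_integral_sliceX (f : 𝓢(ℝ × ℝ × ℝ × ℝ, ℂ)) :
    Integrable fun x : ℝ ↦ √(∫ p, ‖sliceX f x p‖ ^ 2) := by
  obtain ⟨C, hC0, hC⟩ := exists_forall_norm_le_inv_one_add_sq f
  refine (integrable_inv_one_add_sq.const_mul (C * √(∫ w : ℝ × ℝ × ℝ,
    (1 + w.1 ^ 2)⁻¹ * ((1 + w.2.1 ^ 2)⁻¹ * (1 + w.2.2 ^ 2)⁻¹)))).mono' ?_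
    (.of_forall fun x ↦ ?_)
  · have h : Continuous fun q : ℝ × (ℝ × ℝ × ℝ) ↦ ‖f (q.2.1, q.1, q.2.2)‖ ^ 2 := by
      have := f.continuous
      fun_prop
    exact (h.stronglyMeasurable.integral_prod_right'.measurable.sqrt).aestronglyMeasurable
  · rw [Real.norm_of_nonneg (Real.sqrt_nonneg _)]
    have hle : ∫ p, ‖sliceX f x p‖ ^ 2 ≤ (C * (1 + x ^ 2)⁻¹) ^ 2 * ∫ w : ℝ × ℝ × ℝ,
        (1 + w.1 ^ 2)⁻¹ * ((1 + w.2.1 ^ 2)⁻¹ * (1 + w.2.2 ^ 2)⁻¹) := by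
      rw [← integral_const_mul]
      refine integral_mono_of_nonneg (.of_forall fun p ↦ by positivity)
        (integrable_inv_one_add_sq_prod.const_mul _) (.of_forall fun p ↦ ?_)
      have h := hC p.1 x p.2.1 p.2.2
      have hone (a : ℝ) : (1 + a ^ 2)⁻¹ ≤ 1 := inv_le_one_of_one_le₀ (by nlinarith [sq_nonneg a])
      set P := (1 + p.1 ^ 2)⁻¹ * ((1 + p.2.1 ^ 2)⁻¹ * (1 + p.2.2 ^ 2)⁻¹) with hP
      have hP0 : 0 ≤ P := by positivity
      have hP1 : P ≤ 1 :=
        mul_le_one₀ (hone _) (by positivity) (mul_le_one₀ (hone _) (by positivity) (hone _))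
      calc ‖sliceX f x p‖ ^ 2 ≤ (C * (1 + x ^ 2)⁻¹ * P) ^ 2 := by
            refine pow_le_pow_left₀ (norm_nonneg _) (h.trans_eq ?_) 2
            rw [hP]
            ring
        _ = (C * (1 + x ^ 2)⁻¹) ^ 2 * (P * P) := by ring
        _ ≤ (C * (1 + x ^ 2)⁻¹) ^ 2 * P :=
            mul_le_mul_of_nonneg_left (mul_le_of_le_one_left hP0 hP1) (by positivity)
    refine (Real.sqrt_le_sqrt hle).trans_eq ?_
    rw [Real.sqrt_mul (by positivity), Real.sqrt_sq (by positivity)]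
    ring

lemma integrable_norm_sq_slice_slice (f : 𝓢(ℝ × ℝ × ℝ × ℝ, ℂ)) (t x : ℝ) :
    Integrable fun k : ℝ × ℝ ↦ ‖f (t, x, k)‖ ^ 2 := by
  obtain ⟨C, hC0, hC⟩ := exists_forall_norm_le_inv_one_add_sq f
  refine ((integrable_inv_one_add_sq.mul_prod integrable_inv_one_add_sq).const_mul
    (C ^ 2)).mono' ?_ (.of_forall fun k ↦ ?_)
  · have := f.continuous
    exact Continuous.aestronglyMeasurable (by fun_prop)
  · have hone (a : ℝ) : (1 + a ^ 2)⁻¹ ≤ 1 := inv_le_one_of_one_le₀ (by nlinarith [sq_nonneg a])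
    set P := (1 + k.1 ^ 2)⁻¹ * (1 + k.2 ^ 2)⁻¹ with hP
    have hP0 : 0 ≤ P := by positivity
    have hP1 : P ≤ 1 := mul_le_one₀ (hone _) (by positivity) (hone _)
    have h : ‖f (t, x, k)‖ ≤ C * P := by
      refine (hC t x k.1 k.2).trans (mul_le_mul_of_nonneg_left ?_ hC0)
      exact (mul_le_of_le_one_left (by positivity) (hone t)).trans
        (mul_le_of_le_one_left hP0 (hone x))
    rw [Real.norm_of_nonneg (by positivity)]
    calc ‖f (t, x, k)‖ ^ 2 ≤ (C * P) ^ 2 := pow_le_pow_left₀ (norm_nonneg _) h 2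
      _ = C ^ 2 * (P * P) := by ring
      _ ≤ C ^ 2 * P :=
          mul_le_mul_of_nonneg_left (mul_le_of_le_one_left hP0 hP1) (by positivity)

lemma integral_norm_sq_sliceX (f : 𝓢(ℝ × ℝ × ℝ × ℝ, ℂ)) (x : ℝ) :
    ∫ p, ‖sliceX f x p‖ ^ 2 = ∫ t : ℝ, ∫ y : ℝ, ∫ z : ℝ, ‖f (t, x, y, z)‖ ^ 2 := by
  have h : Integrable (fun p ↦ ‖sliceX f x p‖ ^ 2)
      ((volume : Measure ℝ).prod (volume : Measure (ℝ × ℝ))) :=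
    ((sliceX f x).memLp 2).integrable_norm_pow (by norm_num)
  rw [Measure.volume_eq_prod, integral_prod _ h]
  refine integral_congr_ae (.of_forall fun t ↦ ?_)
  have ht := integrable_norm_sq_slice_slice f t x
  rw [Measure.volume_eq_prod] at ht
  exact integral_prod _ ht

lemma lintegral_en3_mul_ft3_sliceX_le (f : 𝓢(ℝ × ℝ × ℝ × ℝ, ℂ)) (x : ℝ) :
    ∫⁻ ξ, (ENNReal.ofReal (en3 ξ) * ‖ft3 (sliceX f x) (omega3 ξ, ξ.2)‖ₑ) ^ 2 ≤
      ENNReal.ofReal ((2 * π) ^ 3 * ∫ p, ‖sliceX f x p‖ ^ 2) := by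
  calc _ = ∫⁻ ξ : ℝ × ℝ × ℝ, ENNReal.ofReal (dot3 ξ ξ) *
        ‖ft3 (sliceX f x) (omega3 ξ, ξ.2)‖ₑ ^ 2 := by
        refine lintegral_congr fun ξ ↦ ?_
        have he : 0 ≤ en3 ξ := Real.sqrt_nonneg _
        rw [mul_pow, ← ENNReal.ofReal_pow he, en3, Real.sq_sqrt]
        simp only [dot3]
        nlinarith [sq_nonneg ξ.1, sq_nonneg ξ.2.1, sq_nonneg ξ.2.2]
    _ ≤ ∫⁻ q, ‖ft3 (sliceX f x) q‖ₑ ^ 2 :=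
        lintegral_dot3_mul_comp_omega3_le
          ((ft3 (sliceX f x)).continuous.measurable.enorm.pow_const 2)
    _ = _ := by
        rw [lintegral_enorm_sq_ft3, lintegral_enorm_sq_ofReal, ENNReal.ofReal_mul (by positivity)]

lemma lintegral_sum_enorm_sq_dualSmooth_le (f : 𝓢(ℝ × ℝ × ℝ × ℝ, ℂ)) :
    ∫⁻ x, ∑ j : Fin 3, ‖dualSmooth f j x‖ₑ ^ 2 ≤
      ENNReal.ofReal ((∫ x : ℝ, √(∫ p, ‖sliceX f x p‖ ^ 2)) ^ 2) := by
  have hm : Measurable (Function.uncurry fun (x : ℝ) (ξ : ℝ × ℝ × ℝ) ↦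
      ENNReal.ofReal (en3 ξ) * ‖ft3 (sliceX f x) (omega3 ξ, ξ.2)‖ₑ) := by
    have h1 : Measurable en3 :=
      (continuous_dot3.comp (continuous_id.prodMk continuous_id)).measurable.sqrt
    have h2 := (measurable_ft3_sliceX f).comp (measurable_fst.prodMk
      ((continuous_omega3.measurable.comp measurable_snd).prodMk measurable_snd.snd))
    exact (h1.comp measurable_snd).ennreal_ofReal.mul h2.enorm
  have hpos : (0 : ℝ) ≤ (2 * π) ^ 3 := by positivity
  have hR : 0 ≤ ∫ x : ℝ, √(∫ p, ‖sliceX f x p‖ ^ 2) :=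
    integral_nonneg fun x ↦ Real.sqrt_nonneg _
  have hbound : ∫⁻ ξ, (ENNReal.ofReal (en3 ξ) * ‖restrictFT f ξ‖ₑ) ^ 2 ≤
      ENNReal.ofReal ((2 * π) ^ 3 * (∫ x : ℝ, √(∫ p, ‖sliceX f x p‖ ^ 2)) ^ 2) := by
    calc _ ≤ ∫⁻ ξ, (∫⁻ x : ℝ, ENNReal.ofReal (en3 ξ) *
          ‖ft3 (sliceX f x) (omega3 ξ, ξ.2)‖ₑ) ^ 2 := by
          refine lintegral_mono fun ξ ↦ pow_le_pow_left₀ zero_le ?_ 2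
          rw [lintegral_const_mul' _ _ ENNReal.ofReal_ne_top]
          exact mul_le_mul_right (enorm_restrictFT_le f ξ) _
      _ ≤ (∫⁻ x : ℝ, (∫⁻ ξ, (ENNReal.ofReal (en3 ξ) *
          ‖ft3 (sliceX f x) (omega3 ξ, ξ.2)‖ₑ) ^ 2) ^ (1 / 2 : ℝ)) ^ 2 :=
          lintegral_sq_lintegral_le _ _ hm
      _ ≤ (∫⁻ x : ℝ, ENNReal.ofReal (√((2 * π) ^ 3) * √(∫ p, ‖sliceX f x p‖ ^ 2))) ^ 2 := by
          refine pow_le_pow_left₀ zero_le (lintegral_mono fun x ↦ ?_) 2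
          refine (ENNReal.rpow_le_rpow (lintegral_en3_mul_ft3_sliceX_le f x)
            (by norm_num)).trans_eq ?_
          rw [ENNReal.ofReal_rpow_of_nonneg (by positivity) (by norm_num), ← Real.sqrt_eq_rpow,
            Real.sqrt_mul hpos]
      _ = _ := by
          rw [← ofReal_integral_eq_lintegral_ofReal
            ((integrable_sqrt_integral_sliceX f).const_mul _)
            (.of_forall fun x ↦ by positivity), integral_const_mul,
            ← ENNReal.ofReal_pow (by positivity), mul_pow, Real.sq_sqrt hpos]
  rw [lintegral_sum_enorm_sq_dualSmooth]
  refine (mul_le_mul_right hbound _).trans_eq ?_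
  rw [← ENNReal.ofReal_mul (by positivity), ← mul_assoc, inv_mul_cancel₀ (by positivity), one_mul]

/-- Estimate (dual-smooth): ‖∫_ℝ U(-t')∇f(t')dt'‖_{L²} ≲ ‖f‖_{L¹_x L²_{yzt}}. -/
theorem dual_kato_smoothing :
    ∃ C : ℝ, 0 < C ∧ ∀ f : SchwartzMap (ℝ × ℝ × ℝ × ℝ) ℂ,
      Real.sqrt (∫ x : ℝ × ℝ × ℝ, ∑ j : Fin 3, ‖dualSmooth (⇑f) j x‖ ^ 2)
      ≤ C * ∫ x : ℝ, Real.sqrt (∫ t : ℝ, ∫ y : ℝ, ∫ z : ℝ, ‖f (t, x, y, z)‖ ^ 2) := by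
  refine ⟨1, one_pos, fun f ↦ ?_⟩
  simp only [one_mul, ← integral_norm_sq_sliceX]
  refine Real.sqrt_le_iff.2 ⟨integral_nonneg fun x ↦ Real.sqrt_nonneg _, ?_⟩
  by_cases hint : Integrable fun x ↦ ∑ j : Fin 3, ‖dualSmooth f j x‖ ^ 2
  · rw [← ENNReal.ofReal_le_ofReal_iff (sq_nonneg _),
      ofReal_integral_eq_lintegral_ofReal hint (.of_forall fun x ↦ by positivity)]
    refine le_trans (lintegral_congr fun x ↦ ?_).le (lintegral_sum_enorm_sq_dualSmooth_le f)
    rw [ENNReal.ofReal_sum_of_nonneg fun j _ ↦ by positivity]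
    simp only [ENNReal.ofReal_pow (norm_nonneg _), ofReal_norm]
  · rw [integral_undef hint]
    positivity
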